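/- arXiv:2310.00012 — 6 statements merged into one kernel-verified Lean document; each statement's English description precedes it below -/
import Mathlib

section
/- For every natural number n, the n-th Legendre polynomial P_n satisfies Legendre's differential equation as a polynomial identity: (1 - x^2)·P_n''(x) - 2x·P_n'(x) + n(n+1)·P_n(x) = 0. -/
open Polynomial

/-- The `n`-th Legendre polynomial, defined via Rodrigues' formula
`P n = (1/(2^n n!)) * d^n/dx^n (x^2 - 1)^n`. -/
noncomputable def legendre (n : ℕ) : Polynomial ℝ :=
  C (1 / ((2 : ℝ) ^ n * n.factorial)) * derivative^[n] ((X ^ 2 - 1) ^ n)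

theorem X_sq_sub_one_mul_derivative_pow {R : Type*} [CommRing R] (n : ℕ) :
    (X ^ 2 - 1 : R[X]) * derivative ((X ^ 2 - 1) ^ n) = 2 * (n : R[X]) * X * (X ^ 2 - 1) ^ n := by
  cases n with
  | zero => simp
  | succ m =>
    simp only [derivative_pow, derivative_sub, derivative_X, derivative_one, map_natCast,
      Nat.add_sub_cancel]
    push_cast
    ring

/-- The differential equation satisfied by the `k`-th derivative of `(X ^ 2 - 1) ^ n`. -/
theorem iterate_derivative_X_sq_sub_one_pow_ODE {R : Type*} [CommRing R] (n k : ℕ) :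
    (X ^ 2 - 1 : R[X]) * derivative (derivative (derivative^[k] ((X ^ 2 - 1) ^ n)))
      + (2 * (k : R[X]) + 2 - 2 * (n : R[X])) * X * derivative (derivative^[k] ((X ^ 2 - 1) ^ n))
      + ((k : R[X]) + 1) * ((k : R[X]) - 2 * (n : R[X])) *
        derivative^[k] ((X ^ 2 - 1) ^ n) = 0 := by
  induction k with
  | zero =>
    have h := congrArg derivative (X_sq_sub_one_mul_derivative_pow (R := R) n)
    simp only [Function.iterate_zero, id_eq]
    generalize ((X ^ 2 - 1 : R[X]) ^ n) = u at h ⊢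
    simp only [derivative_mul, derivative_sub, derivative_X_pow, derivative_X, derivative_one,
      derivative_natCast, derivative_ofNat, map_natCast] at h
    push_cast at h ⊢
    linear_combination h
  | succ k ih =>
    have h := congrArg derivative ih
    simp only [Function.iterate_succ_apply']
    generalize derivative^[k] ((X ^ 2 - 1 : R[X]) ^ n) = u at h ⊢
    simp only [derivative_mul, derivative_add, derivative_sub, derivative_X_pow, derivative_X,
      derivative_one, derivative_natCast, derivative_ofNat, map_natCast, derivative_zero] at h
    push_cast at h ⊢
    linear_combination h

/-- Legendre's differential equation:
`(1 - x^2) P_n''(x) - 2x P_n'(x) + n(n+1) P_n(x) = 0` as a polynomial identity. -/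
theorem legendre_ODE (n : ℕ) :
    (1 - X ^ 2) * derivative (derivative (legendre n)) - C 2 * X * derivative (legendre n)
      + C ((n : ℝ) * (n + 1)) * legendre n = 0 := by
  have h := iterate_derivative_X_sq_sub_one_pow_ODE (R := ℝ) n n
  simp only [legendre, derivative_C_mul, map_mul, map_add, map_natCast, map_one, map_ofNat]
  linear_combination -C (1 / ((2 : ℝ) ^ n * n.factorial)) * h
end

section
/- For every natural number n and every real x with -1 ≤ x ≤ 1, the n-th Legendre polynomial satisfies |P_n(x)| ≤ 1. -/
open Polynomial

/-- The differential equation satisfied by the iterated derivatives of `(X ^ 2 - 1) ^ n`. -/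
lemma iterate_derivative_X_sq_sub_one_pow (n k : ℕ) :
    (X ^ 2 - 1) * derivative^[k + 2] ((X ^ 2 - 1) ^ n : ℝ[X])
      + 2 * ((k : ℝ[X]) + 1 - (n : ℝ[X])) * X * derivative^[k + 1] ((X ^ 2 - 1) ^ n : ℝ[X])
      + ((k : ℝ[X]) + 1) * ((k : ℝ[X]) - 2 * (n : ℝ[X])) *
        derivative^[k] ((X ^ 2 - 1) ^ n : ℝ[X]) = 0 := by
  induction k with
  | zero =>
    have h : ((X : ℝ[X]) ^ 2 - 1) * derivative ((X ^ 2 - 1) ^ n)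
        = 2 * (n : ℝ[X]) * X * (X ^ 2 - 1) ^ n := by
      cases n with
      | zero => simp
      | succ m =>
        rw [derivative_pow_succ]
        simp only [derivative_sub, derivative_X_pow, derivative_one, map_add, map_natCast, map_one]
        push_cast
        ring
    have h' := congrArg derivative h
    simp only [derivative_mul, derivative_sub, derivative_X_pow, derivative_one, derivative_X,
      derivative_natCast, derivative_ofNat] at h'
    simp only [Function.iterate_succ, Function.iterate_zero, Function.comp, id] at h' ⊢
    push_cast at h' ⊢
    simp only [map_ofNat] at h'
    linear_combination h'
  | succ k ih =>
    have h' := congrArg derivative ih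
    simp only [derivative_add, derivative_mul, derivative_sub, derivative_X_pow, derivative_one,
      derivative_X, derivative_natCast, derivative_ofNat, derivative_zero,
      ← Function.iterate_succ_apply'] at h'
    push_cast at h' ⊢
    simp only [map_ofNat] at h'
    linear_combination h'

/-- The Legendre differential equation. -/
lemma legendre_ode (n : ℕ) (x : ℝ) :
    (1 - x ^ 2) * (derivative (derivative (legendre n))).eval x
      = 2 * x * (derivative (legendre n)).eval x - n * (n + 1) * (legendre n).eval x := by
  have h := congrArg (eval x) (iterate_derivative_X_sq_sub_one_pow n n)
  simp only [Function.iterate_succ_apply', eval_add, eval_mul, eval_sub, eval_pow, eval_X,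
    eval_one, eval_natCast, eval_ofNat, eval_zero] at h
  simp only [legendre, derivative_C_mul, eval_mul, eval_C]
  linear_combination (-(1 / ((2 : ℝ) ^ n * n.factorial))) * h

lemma legendre_eval_one (n : ℕ) : (legendre n).eval 1 = 1 := by
  have h := aeval_iterate_derivative_self (A := ℝ) ((X ^ 2 - 1) ^ n : ℝ[X]) n (r := 1)
    (p' := (X + 1) ^ n) (by simp [← mul_pow]; ring)
  simp only [coe_aeval_eq_eval] at h
  rw [legendre, eval_mul, eval_C, h]
  simp only [eval_pow, eval_add, eval_X, eval_one, nsmul_eq_mul]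
  norm_num
  field_simp

lemma legendre_eval_neg_one (n : ℕ) : (legendre n).eval (-1) = (-1) ^ n := by
  have h := aeval_iterate_derivative_self (A := ℝ) ((X ^ 2 - 1) ^ n : ℝ[X]) n (r := -1)
    (p' := (X - 1) ^ n) (by simp [← mul_pow]; ring)
  simp only [coe_aeval_eq_eval] at h
  rw [legendre, eval_mul, eval_C, h]
  simp only [eval_pow, eval_sub, eval_X, eval_one, nsmul_eq_mul]
  rw [show (-1 - 1 : ℝ) = -1 * 2 by norm_num, mul_pow]
  field_simp

/-- For `-1 ≤ x ≤ 1`, `|P_n(x)| ≤ 1`. -/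
theorem abs_legendre_le_one (n : ℕ) (x : ℝ) (hx₁ : -1 ≤ x) (hx₂ : x ≤ 1) :
    |(legendre n).eval x| ≤ 1 := by
  rcases Nat.eq_zero_or_pos n with rfl | hn
  · simp [legendre]
  have hN : (0 : ℝ) < n * (n + 1) := by positivity
  -- The Sonin function: its derivative has the sign of `x`
  set F : ℝ[X] := C (n * (n + 1) : ℝ) * legendre n ^ 2
    + (1 - X ^ 2) * derivative (legendre n) ^ 2 with hF
  have hF' (y : ℝ) : deriv (fun z => F.eval z) y
      = 2 * y * (derivative (legendre n)).eval y ^ 2 := by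
    rw [Polynomial.deriv, hF]
    simp only [derivative_add, derivative_mul, derivative_sub, derivative_X, derivative_one,
      derivative_C, derivative_pow, eval_add, eval_mul, eval_sub, eval_pow, eval_X, eval_one,
      eval_C, eval_zero]
    push_cast
    linear_combination (2 * (derivative (legendre n)).eval y) * legendre_ode n y
  have hFx : F.eval x ≤ n * (n + 1) := by
    rcases le_total 0 x with h0 | h0
    · have hmono : MonotoneOn (fun z => F.eval z) (Set.Icc 0 1) := by
        refine monotoneOn_of_deriv_nonneg (convex_Icc 0 1) F.continuous.continuousOn
          F.differentiable.differentiableOn fun y hy => ?_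
        rw [interior_Icc] at hy
        rw [hF']
        have := hy.1
        positivity
      refine (hmono ⟨h0, hx₂⟩ (Set.right_mem_Icc.2 zero_le_one) hx₂).trans_eq ?_
      simp [hF, legendre_eval_one]
    · have hanti : AntitoneOn (fun z => F.eval z) (Set.Icc (-1) 0) := by
        refine antitoneOn_of_deriv_nonpos (convex_Icc (-1) 0) F.continuous.continuousOn
          F.differentiable.differentiableOn fun y hy => ?_
        rw [interior_Icc] at hy
        rw [hF']
        exact mul_nonpos_of_nonpos_of_nonneg (by linarith [hy.2]) (sq_nonneg _)
      refine (hanti (Set.left_mem_Icc.2 (by norm_num)) ⟨hx₁, h0⟩ hx₁).trans_eq ?_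
      simp [hF, legendre_eval_neg_one, ← pow_mul]
  rw [← sq_le_one_iff_abs_le_one]
  refine le_of_mul_le_mul_left ?_ hN
  have hrest : 0 ≤ (1 - x ^ 2) * (derivative (legendre n)).eval x ^ 2 :=
    mul_nonneg (by nlinarith) (sq_nonneg _)
  simp only [hF, eval_add, eval_mul, eval_sub, eval_pow, eval_X, eval_one, eval_C] at hFx
  linarith
end

section
/- For all natural numbers n and m with n ≠ m, the Legendre polynomials are orthogonal on [-1,1]: ∫_{-1}^{1} P_n(x)·P_m(x) dx = 0. -/
open Polynomial

/-- If the derivatives of `f` of order less than `k` vanish at both endpoints, then the `k`-th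
derivative of `f` is orthogonal to every polynomial whose `k`-th derivative is zero. -/
theorem Polynomial.integral_iterate_derivative_mul_eq_zero {a b : ℝ} (f : ℝ[X]) {k : ℕ}
    (ha : ∀ j < k, (derivative^[j] f).eval a = 0) (hb : ∀ j < k, (derivative^[j] f).eval b = 0)
    {p : ℝ[X]} (hp : derivative^[k] p = 0) :
    ∫ x in a..b, (derivative^[k] f).eval x * p.eval x = 0 := by
  induction k generalizing p with
  | zero => simp_all
  | succ k ih =>
    have hparts := intervalIntegral.integral_mul_deriv_eq_deriv_mul (a := a) (b := b)
      (fun x _ => p.hasDerivAt x) (fun x _ => (derivative^[k] f).hasDerivAt x)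
      (p.derivative.continuous.intervalIntegrable _ _)
      ((derivative (derivative^[k] f)).continuous.intervalIntegrable _ _)
    have hlower := ih (fun j hj => ha j (by lia)) (fun j hj => hb j (by lia))
      (p := derivative p) hp
    simp only [mul_comm (eval _ (derivative p)), hlower, ha k k.lt_succ_self,
      hb k k.lt_succ_self, mul_zero, sub_zero] at hparts
    simpa only [Function.iterate_succ_apply', mul_comm] using hparts

theorem eval_iterate_derivative_X_sq_sub_one_pow {n j : ℕ} (hj : j < n) {x : ℝ}
    (hx : x ^ 2 = 1) : (derivative^[j] ((X ^ 2 - 1 : ℝ[X]) ^ n)).eval x = 0 := by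
  apply eval_eq_zero_of_dvd_of_eval_eq_zero (pow_sub_dvd_iterate_derivative_pow _ n j)
  simp [hx, (Nat.sub_pos_of_lt hj).ne']

theorem natDegree_legendre_le (n : ℕ) : (legendre n).natDegree ≤ n := by
  have hpow : ((X ^ 2 - 1 : ℝ[X]) ^ n).natDegree ≤ n * 2 :=
    natDegree_pow_le_of_le n (by compute_degree)
  have hder := natDegree_iterate_derivative ((X ^ 2 - 1 : ℝ[X]) ^ n) n
  exact (natDegree_C_mul_le _ _).trans (by lia)

theorem integral_legendre_mul_legendre_of_lt {n m : ℕ} (hmn : m < n) :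
    ∫ x in (-1 : ℝ)..1, (legendre n).eval x * (legendre m).eval x = 0 := by
  have h := integral_iterate_derivative_mul_eq_zero ((X ^ 2 - 1 : ℝ[X]) ^ n)
    (fun j hj => eval_iterate_derivative_X_sq_sub_one_pow hj (x := -1) (by norm_num))
    (fun j hj => eval_iterate_derivative_X_sq_sub_one_pow hj (x := 1) (by norm_num))
    (iterate_derivative_eq_zero ((natDegree_legendre_le m).trans_lt hmn))
  rw [legendre]
  simp only [eval_mul, eval_C, mul_assoc, intervalIntegral.integral_const_mul, h, mul_zero]

/-- Orthogonality of the Legendre polynomials on `[-1, 1]`. -/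
theorem legendre_orthogonal (n m : ℕ) (hnm : n ≠ m) :
    ∫ x in (-1 : ℝ)..1, (legendre n).eval x * (legendre m).eval x = 0 := by
  rcases hnm.lt_or_gt with h | h
  · simpa only [mul_comm] using integral_legendre_mul_legendre_of_lt h
  · exact integral_legendre_mul_legendre_of_lt h
end

section
/- For all real x with -1 ≤ x ≤ 1 and all real t with |t| < 1, the generating function identity Σ_{n=0}^{∞} P_n(x)·t^n = (1 - 2xt + t^2)^{-1/2} holds, the series on the left converging. -/
open Polynomial

theorem iterate_derivative_X_mul_succ {R : Type*} [CommRing R] (n : ℕ) (p : R[X]) :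
    derivative^[n + 1] (X * p) = X * derivative^[n + 1] p + (n + 1 : R[X]) * derivative^[n] p := by
  induction n with
  | zero => simp [add_comm]
  | succ n ih =>
    rw [Function.iterate_succ_apply', ih]
    simp only [Function.iterate_succ_apply', derivative_add, derivative_mul, derivative_X]
    simp
    ring

theorem rodrigues_recurrence {R : Type*} [CommRing R] (n : ℕ) :
    derivative^[n + 2] ((X ^ 2 - 1 : R[X]) ^ (n + 2)) =
      2 * (2 * n + 3 : R[X]) * X * derivative^[n + 1] ((X ^ 2 - 1 : R[X]) ^ (n + 1)) -
        4 * (n + 1 : R[X]) ^ 2 * derivative^[n] ((X ^ 2 - 1 : R[X]) ^ n) := by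
  have hd (m : ℕ) : derivative ((X ^ 2 - 1 : R[X]) ^ (m + 1)) =
      (2 * (m + 1) : ℕ) • (X * (X ^ 2 - 1) ^ m) := by
    rw [derivative_pow_succ]
    simp
    ring
  have h₁ : derivative^[n + 2] ((X ^ 2 - 1 : R[X]) ^ (n + 2)) =
      2 * (n + 2 : R[X]) * (X * derivative^[n + 1] ((X ^ 2 - 1 : R[X]) ^ (n + 1)) +
        (n + 1 : R[X]) * derivative^[n] ((X ^ 2 - 1 : R[X]) ^ (n + 1))) := by
    rw [Function.iterate_succ_apply, hd, iterate_derivative_smul, iterate_derivative_X_mul_succ,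
      nsmul_eq_mul]
    push_cast
    ring
  have h₂ : (n + 2 : R[X]) * derivative^[n] ((X ^ 2 - 1 : R[X]) ^ (n + 1)) =
      X * derivative^[n + 1] ((X ^ 2 - 1 : R[X]) ^ (n + 1)) -
        2 * (n + 1 : R[X]) * derivative^[n] ((X ^ 2 - 1 : R[X]) ^ n) := by
    have h : derivative^[n + 1] (X * (X ^ 2 - 1 : R[X]) ^ (n + 1)) =
        (2 * n + 3 : ℕ) • derivative^[n] ((X ^ 2 - 1 : R[X]) ^ (n + 1)) +
          (2 * (n + 1) : ℕ) • derivative^[n] ((X ^ 2 - 1 : R[X]) ^ n) := by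
      rw [Function.iterate_succ_apply, ← iterate_derivative_smul, ← iterate_derivative_smul,
        ← iterate_map_add, derivative_mul, hd]
      congr 1
      simp
      ring
    rw [iterate_derivative_X_mul_succ] at h
    simp only [nsmul_eq_mul] at h
    push_cast at h
    linear_combination -h
  linear_combination h₁ + 2 * (n + 1 : R[X]) * h₂

theorem legendre_zero : legendre 0 = 1 := by simp [legendre]

theorem legendre_one : legendre 1 = X := by
  ext n
  simp [legendre, ← mul_assoc, one_add_one_eq_two, ← C_mul]

theorem legendre_recurrence (n : ℕ) (x : ℝ) :
    (n + 2) * (legendre (n + 2)).eval x =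
      (2 * n + 3) * x * (legendre (n + 1)).eval x - (n + 1) * (legendre n).eval x := by
  simp only [legendre, eval_mul, eval_C, rodrigues_recurrence n, eval_sub, eval_add, eval_pow,
    eval_X, eval_natCast, eval_ofNat, eval_one, Nat.factorial_succ]
  generalize eval x (derivative^[n] _) = u
  generalize eval x (derivative^[n + 1] _) = v
  push_cast
  field_simp
  ring

/-- The Taylor series of `(1 - a * z) ^ (-1 / 2)`. -/
noncomputable def invSqrtSeries {K : Type*} [Field K] (a : K) : PowerSeries K :=
  PowerSeries.mk fun n => (n.centralBinom : K) / 4 ^ n * a ^ n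

section InvSqrtSeries

variable {K : Type*} [Field K] [CharZero K]

theorem derivative_invSqrtSeries (a : K) :
    (1 - PowerSeries.C a * PowerSeries.X) * PowerSeries.derivative K (invSqrtSeries a) =
      PowerSeries.C (a / 2) * invSqrtSeries a := by
  have hc (n : ℕ) : (n + 1 : K) * (n + 1).centralBinom = 2 * (2 * n + 1) * n.centralBinom := by
    exact_mod_cast Nat.succ_mul_centralBinom_succ n
  ext n
  rw [sub_mul, one_mul, mul_assoc, map_sub, PowerSeries.coeff_C_mul, PowerSeries.coeff_C_mul]
  cases n with
  | zero =>
    simp [invSqrtSeries, PowerSeries.coeff_derivative, Nat.centralBinom, Nat.choose]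
    ring
  | succ n =>
    simp only [PowerSeries.coeff_succ_X_mul, PowerSeries.coeff_derivative, invSqrtSeries,
      PowerSeries.coeff_mk]
    have := hc (n + 1)
    push_cast at this ⊢
    linear_combination a ^ (n + 2) / 4 ^ (n + 2) * this

theorem coeff_invSqrtSeries_mul_recurrence (a b : K) (n : ℕ) :
    (n + 2) * PowerSeries.coeff (n + 2) (invSqrtSeries a * invSqrtSeries b) =
      (2 * n + 3) * ((a + b) / 2) *
          PowerSeries.coeff (n + 1) (invSqrtSeries a * invSqrtSeries b) -
        (n + 1) * (a * b) * PowerSeries.coeff n (invSqrtSeries a * invSqrtSeries b) := by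
  have hode : PowerSeries.derivative K (invSqrtSeries a * invSqrtSeries b) -
      PowerSeries.C (a + b) *
        (PowerSeries.X * PowerSeries.derivative K (invSqrtSeries a * invSqrtSeries b)) +
      PowerSeries.C (a * b) * (PowerSeries.X *
        (PowerSeries.X * PowerSeries.derivative K (invSqrtSeries a * invSqrtSeries b))) =
      PowerSeries.C ((a + b) / 2) * (invSqrtSeries a * invSqrtSeries b) -
        PowerSeries.C (a * b) * (PowerSeries.X * (invSqrtSeries a * invSqrtSeries b)) := by
    have hC (c : K) : PowerSeries.C c = 2 * PowerSeries.C (c / 2) := by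
      rw [← map_ofNat PowerSeries.C 2, ← map_mul]
      congr 1
      field_simp
    have ha := derivative_invSqrtSeries a
    have hb := derivative_invSqrtSeries b
    rw [Derivation.leibniz, smul_eq_mul, smul_eq_mul, add_div]
    simp only [map_add, map_mul]
    rw [hC a] at ha ⊢
    rw [hC b] at hb ⊢
    linear_combination
      (1 - 2 * PowerSeries.C (b / 2) * PowerSeries.X) * invSqrtSeries b * ha +
        (1 - 2 * PowerSeries.C (a / 2) * PowerSeries.X) * invSqrtSeries a * hb
  have h := congrArg (PowerSeries.coeff (n + 1)) hode
  cases n with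
  | zero =>
    simp only [map_add (PowerSeries.coeff _), map_sub, PowerSeries.coeff_C_mul, PowerSeries.coeff_succ_X_mul,
      PowerSeries.coeff_zero_X_mul, PowerSeries.coeff_derivative] at h
    push_cast at h ⊢
    linear_combination h
  | succ n =>
    simp only [map_add (PowerSeries.coeff _), map_sub, PowerSeries.coeff_C_mul, PowerSeries.coeff_succ_X_mul,
      PowerSeries.coeff_derivative] at h
    push_cast at h ⊢
    linear_combination h

theorem coeff_zero_invSqrtSeries_mul (a b : K) :
    PowerSeries.coeff 0 (invSqrtSeries a * invSqrtSeries b) = 1 := by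
  simp [PowerSeries.coeff_mul, invSqrtSeries]

theorem coeff_one_invSqrtSeries_mul (a b : K) :
    PowerSeries.coeff 1 (invSqrtSeries a * invSqrtSeries b) = (a + b) / 2 := by
  simp [PowerSeries.coeff_mul, invSqrtSeries, Finset.Nat.antidiagonal_succ, Nat.centralBinom,
    Nat.choose]
  ring

theorem coeff_invSqrtSeries_one_mul_self (n : ℕ) :
    PowerSeries.coeff n (invSqrtSeries (1 : K) * invSqrtSeries 1) = 1 := by
  induction n using Nat.twoStepInduction with
  | zero => exact coeff_zero_invSqrtSeries_mul _ _
  | one => rw [coeff_one_invSqrtSeries_mul]; norm_num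
  | more n h₀ h₁ =>
    have h := coeff_invSqrtSeries_mul_recurrence (1 : K) 1 n
    rw [h₀, h₁] at h
    have hn : (n + 2 : K) ≠ 0 := by exact_mod_cast (n + 1).succ_ne_zero
    apply mul_left_cancel₀ hn
    rw [h]
    ring

end InvSqrtSeries

theorem coeff_invSqrtSeries_mul_eq_legendre {a b : ℂ} {x : ℝ} (hs : a + b = 2 * x)
    (hp : a * b = 1) (n : ℕ) :
    PowerSeries.coeff n (invSqrtSeries a * invSqrtSeries b) = ((legendre n).eval x : ℝ) := by
  induction n using Nat.twoStepInduction with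
  | zero => simp [coeff_zero_invSqrtSeries_mul, legendre_zero]
  | one => simp [coeff_one_invSqrtSeries_mul, legendre_one, hs]
  | more n h₀ h₁ =>
    have h := coeff_invSqrtSeries_mul_recurrence a b n
    have hl := congrArg (fun y : ℝ => (y : ℂ)) (legendre_recurrence n x)
    push_cast at hl
    rw [h₀, h₁, hs, hp] at h
    have hn : (n + 2 : ℂ) ≠ 0 := by exact_mod_cast (n + 1).succ_ne_zero
    apply mul_left_cancel₀ hn
    rw [h, hl]
    ring

theorem summable_norm_coeff_invSqrtSeries {a z : ℂ} (h : ‖a * z‖ < 1) :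
    Summable fun n => ‖PowerSeries.coeff n (invSqrtSeries a) * z ^ n‖ := by
  refine Summable.of_nonneg_of_le (fun _ => norm_nonneg _) (fun n => ?_)
    (summable_geometric_of_lt_one (norm_nonneg _) h)
  have hc : (n.centralBinom : ℝ) / 4 ^ n ≤ 1 := by
    rw [div_le_one (by positivity)]
    exact_mod_cast n.centralBinom_le_four_pow
  rw [invSqrtSeries, PowerSeries.coeff_mk, mul_assoc, ← mul_pow, norm_mul, norm_pow]
  refine mul_le_of_le_one_left (by positivity) ?_
  simpa using hc

theorem hasSum_coeff_mul_of_summable_norm {f g : PowerSeries ℂ} {z : ℂ}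
    (hf : Summable fun n => ‖PowerSeries.coeff n f * z ^ n‖)
    (hg : Summable fun n => ‖PowerSeries.coeff n g * z ^ n‖) :
    HasSum (fun n => PowerSeries.coeff n (f * g) * z ^ n)
      ((∑' n, PowerSeries.coeff n f * z ^ n) * ∑' n, PowerSeries.coeff n g * z ^ n) := by
  have h (n : ℕ) : PowerSeries.coeff n (f * g) * z ^ n =
      ∑ p ∈ Finset.HasAntidiagonal.antidiagonal n,
        (PowerSeries.coeff p.1 f * z ^ p.1) * (PowerSeries.coeff p.2 g * z ^ p.2) := by
    rw [PowerSeries.coeff_mul, Finset.sum_mul]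
    refine Finset.sum_congr rfl fun p hp => ?_
    rw [← Finset.HasAntidiagonal.mem_antidiagonal.mp hp, pow_add]
    ring
  simp only [h]
  rw [tsum_mul_tsum_eq_tsum_sum_antidiagonal_of_summable_norm hf hg]
  exact (summable_norm_sum_mul_antidiagonal_of_summable_norm hf hg).of_norm.hasSum

theorem coeff_invSqrtSeries_mul_pow (a z : ℂ) (n : ℕ) :
    PowerSeries.coeff n (invSqrtSeries a) * z ^ n =
      PowerSeries.coeff n (invSqrtSeries 1) * (a * z) ^ n := by
  simp only [invSqrtSeries, PowerSeries.coeff_mk, one_pow, mul_one, mul_pow]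
  ring

theorem tsum_invSqrtSeries_sq {a z : ℂ} (h : ‖a * z‖ < 1) :
    (∑' n, PowerSeries.coeff n (invSqrtSeries a) * z ^ n) ^ 2 = (1 - a * z)⁻¹ := by
  simp only [coeff_invSqrtSeries_mul_pow a z]
  have hs := summable_norm_coeff_invSqrtSeries (a := 1) (z := a * z) (by simpa using h)
  have hm := hasSum_coeff_mul_of_summable_norm hs hs
  simp only [coeff_invSqrtSeries_one_mul_self, one_mul] at hm
  rw [sq]
  exact hm.unique (hasSum_geometric_of_norm_lt_one h)

open ComplexConjugate in
theorem conj_tsum_invSqrtSeries (a : ℂ) (t : ℝ) :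
    conj (∑' n, PowerSeries.coeff n (invSqrtSeries a) * (t : ℂ) ^ n) =
      ∑' n, PowerSeries.coeff n (invSqrtSeries (conj a)) * (t : ℂ) ^ n := by
  rw [Complex.conj_tsum]
  simp [invSqrtSeries, map_ofNat]

/-- Generating function of the Legendre polynomials:
`Σ_{n=0}^∞ P_n(x) t^n = (1 - 2xt + t^2)^{-1/2}` for `-1 ≤ x ≤ 1`, `|t| < 1`. -/
theorem legendre_generating_function (x t : ℝ) (hx₁ : -1 ≤ x) (hx₂ : x ≤ 1)
    (ht : |t| < 1) :
    HasSum (fun n : ℕ => (legendre n).eval x * t ^ n)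
      ((1 - 2 * x * t + t ^ 2) ^ (-(1 / 2) : ℝ)) := by
  set a : ℂ := ⟨x, √(1 - x ^ 2)⟩ with ha
  have hy : √(1 - x ^ 2) ^ 2 = 1 - x ^ 2 := Real.sq_sqrt (by nlinarith)
  have hnormSq : Complex.normSq a = 1 := by
    rw [Complex.normSq_mk]
    linarith
  have hsum : a + starRingEnd ℂ a = 2 * x := by
    rw [Complex.add_conj]
    push_cast
    rfl
  have hprod : a * starRingEnd ℂ a = 1 := by rw [Complex.mul_conj, hnormSq, Complex.ofReal_one]
  have hnorm : ‖a‖ = 1 := by rw [Complex.norm_def, hnormSq, Real.sqrt_one]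
  have hat : ‖a * t‖ < 1 := by simpa [hnorm] using ht
  have hat' : ‖starRingEnd ℂ a * t‖ < 1 := by simpa [hnorm] using ht
  have hS := hasSum_coeff_mul_of_summable_norm (summable_norm_coeff_invSqrtSeries hat)
    (summable_norm_coeff_invSqrtSeries hat')
  have hsq := tsum_invSqrtSeries_sq hat
  rw [← conj_tsum_invSqrtSeries, Complex.mul_conj] at hS
  simp only [coeff_invSqrtSeries_mul_eq_legendre hsum hprod] at hS
  set S := ∑' n, PowerSeries.coeff n (invSqrtSeries a) * (t : ℂ) ^ n
  have hden : Complex.normSq (1 - a * t) = 1 - 2 * x * t + t ^ 2 := by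
    simp only [Complex.normSq_apply, ha, Complex.sub_re, Complex.sub_im, Complex.mul_re,
      Complex.mul_im, Complex.one_re, Complex.one_im, Complex.ofReal_re, Complex.ofReal_im]
    linear_combination t ^ 2 * hy
  have hval : Complex.normSq S = (1 - 2 * x * t + t ^ 2) ^ (-(1 / 2) : ℝ) := by
    have h := congrArg Complex.normSq hsq
    rw [map_pow, map_inv₀, hden] at h
    have hpos : 0 ≤ 1 - 2 * x * t + t ^ 2 := hden ▸ Complex.normSq_nonneg _
    rw [Real.rpow_neg hpos, ← Real.sqrt_eq_rpow, ← Real.sqrt_inv, ← h,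
      Real.sqrt_sq (Complex.normSq_nonneg _)]
  rw [← hval]
  exact_mod_cast hS
end

section
/- For all real x with -1 ≤ x ≤ 1 and all real t with |t| < 1, differentiating the Legendre generating function with respect to x gives Σ_{n=0}^{∞} P_n'(x)·t^n = t·(1 - 2xt + t^2)^{-3/2}, the series on the left converging. -/
open Polynomial

theorem two_pow_mul_factorial_mul_legendre (n : ℕ) :
    C ((2 : ℝ) ^ n * n.factorial) * legendre n = derivative^[n] ((X ^ 2 - 1) ^ n) := by
  have h : (2 : ℝ) ^ n * n.factorial ≠ 0 := by positivity
  rw [legendre, ← mul_assoc, ← C_mul, mul_one_div_cancel h, C_1, one_mul]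

theorem derivative_X_sq_sub_one_pow_succ (n : ℕ) :
    derivative ((X ^ 2 - 1 : ℝ[X]) ^ (n + 1)) =
      C (2 * (n + 1) : ℝ) * ((X ^ 2 - 1) ^ n * X) := by
  simp [derivative_pow]
  ring

theorem derivative_legendre_succ (n : ℕ) :
    derivative (legendre (n + 1)) =
      X * derivative (legendre n) + C (n + 1 : ℝ) * legendre n := by
  have hc : C ((2 : ℝ) ^ (n + 1) * (n + 1).factorial) ≠ 0 := C_ne_zero.2 (by positivity)
  refine mul_left_cancel₀ hc ?_
  have hD := congrArg derivative (two_pow_mul_factorial_mul_legendre (n + 1))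
  rw [derivative_C_mul] at hD
  have hn := two_pow_mul_factorial_mul_legendre n
  have hn' := congrArg derivative hn
  rw [derivative_C_mul, ← Function.iterate_succ_apply' derivative] at hn'
  rw [hD, ← Function.iterate_succ_apply' derivative, Function.iterate_succ_apply,
    derivative_X_sq_sub_one_pow_succ, iterate_derivative_C_mul, iterate_derivative_mul_X,
    add_tsub_cancel_right, ← hn', ← hn, nsmul_eq_mul, Nat.factorial_succ]
  simp only [map_mul, map_add, map_pow, map_natCast, map_one, Nat.cast_mul, Nat.cast_succ]
  ring

theorem derivative_legendre_add_two (n : ℕ) :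
    derivative (legendre (n + 2)) =
      C (2 * n + 3 : ℝ) * legendre (n + 1) + derivative (legendre n) := by
  have hc : C ((2 : ℝ) ^ (n + 2) * (n + 2).factorial) ≠ 0 := C_ne_zero.2 (by positivity)
  refine mul_left_cancel₀ hc ?_
  have hD := congrArg derivative (two_pow_mul_factorial_mul_legendre (n + 2))
  rw [derivative_C_mul] at hD
  have hn' := congrArg derivative (two_pow_mul_factorial_mul_legendre n)
  rw [derivative_C_mul, ← Function.iterate_succ_apply' derivative] at hn'
  have hn1 := two_pow_mul_factorial_mul_legendre (n + 1)
  have h2 : derivative (derivative ((X ^ 2 - 1 : ℝ[X]) ^ (n + 2))) =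
      C (2 * (n + 2) * (2 * n + 3) : ℝ) * (X ^ 2 - 1) ^ (n + 1) +
        C (4 * (n + 2) * (n + 1) : ℝ) * (X ^ 2 - 1) ^ n := by
    rw [derivative_X_sq_sub_one_pow_succ, derivative_C_mul, derivative_mul,
      derivative_X_sq_sub_one_pow_succ, derivative_X]
    simp only [map_mul, map_add, map_natCast, map_one, map_ofNat, Nat.cast_succ]
    ring
  rw [hD, ← Function.iterate_succ_apply' derivative, Function.iterate_succ_apply,
    Function.iterate_succ_apply, h2, iterate_map_add, iterate_derivative_C_mul,
    iterate_derivative_C_mul, ← hn', ← hn1, Nat.factorial_succ (n + 1), Nat.factorial_succ n]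
  simp only [map_mul, map_add, map_pow, map_natCast, map_one, map_ofNat, Nat.cast_mul,
    Nat.cast_succ]
  ring

theorem derivative_legendre_zero : derivative (legendre 0) = 0 := by
  simp [legendre]

theorem derivative_legendre_one : derivative (legendre 1) = 1 := by
  rw [derivative_legendre_succ, derivative_legendre_zero]
  simp [legendre]

theorem eval_derivative_legendre_recurrence (n : ℕ) (x : ℝ) :
    (n + 1) * (derivative (legendre (n + 2))).eval x =
      (2 * n + 3) * x * (derivative (legendre (n + 1))).eval x -
        (n + 2) * (derivative (legendre n)).eval x := by
  have hA := congrArg (eval x) (derivative_legendre_succ (n + 1))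
  have hB := congrArg (eval x) (derivative_legendre_add_two n)
  simp only [eval_add, eval_mul, eval_X, eval_C] at hA hB
  push_cast at hA
  linear_combination (2 * n + 3 : ℝ) * hA - (n + 2 : ℝ) * hB

theorem Ring.choose_succ_mul_succ {K : Type*} [Field K] [CharZero K] (a : K) (n : ℕ) :
    (n + 1) * Ring.choose a (n + 1) = (a - n) * Ring.choose a n := by
  rw [Ring.choose_eq_smul, Ring.choose_eq_smul, descPochhammer_succ_right, Nat.factorial_succ]
  have h1 : (n.factorial : K) ≠ 0 := Nat.cast_ne_zero.2 n.factorial_ne_zero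
  have h2 : (n + 1 : K) ≠ 0 := Nat.cast_add_one_ne_zero n
  simp [← Polynomial.aeval_eq_smeval, smul_eq_mul]
  field_simp

/-- The power series of `(1 - z * X) ^ (-3 / 2)`. -/
noncomputable def oneSubPowNegThreeHalves (z : ℂ) : PowerSeries ℂ :=
  PowerSeries.mk fun n ↦ Ring.choose (-(3 / 2) : ℂ) n * (-z) ^ n

theorem derivative_oneSubPowNegThreeHalves (z : ℂ) :
    (1 - PowerSeries.C z * PowerSeries.X) *
        PowerSeries.derivative ℂ (oneSubPowNegThreeHalves z) =
      PowerSeries.C (3 / 2 * z) * oneSubPowNegThreeHalves z := by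
  ext n
  rw [sub_mul, one_mul, mul_assoc, map_sub, PowerSeries.coeff_C_mul, PowerSeries.coeff_C_mul]
  cases n with
  | zero =>
    simp [PowerSeries.coeff_derivative, oneSubPowNegThreeHalves]
  | succ n =>
    have h := Ring.choose_succ_mul_succ (-(3 / 2) : ℂ) (n + 1)
    rw [PowerSeries.coeff_succ_X_mul]
    simp only [PowerSeries.coeff_derivative, oneSubPowNegThreeHalves, PowerSeries.coeff_mk]
    push_cast at h ⊢
    linear_combination (-z) ^ (n + 2) * h

theorem coeff_mul_oneSubPowNegThreeHalves (x : ℝ) {z w : ℂ} (hadd : z + w = 2 * x)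
    (hmul : z * w = 1) (n : ℕ) :
    PowerSeries.coeff n (oneSubPowNegThreeHalves z * oneSubPowNegThreeHalves w) =
      (derivative (legendre (n + 1))).eval x := by
  have hz := derivative_oneSubPowNegThreeHalves z
  have hw := derivative_oneSubPowNegThreeHalves w
  set G := oneSubPowNegThreeHalves z * oneSubPowNegThreeHalves w with hG
  have hode : PowerSeries.derivative ℂ G -
        PowerSeries.C (2 * x : ℂ) * (PowerSeries.X * PowerSeries.derivative ℂ G) +
        PowerSeries.X * (PowerSeries.X * PowerSeries.derivative ℂ G) =
      PowerSeries.C (3 * x : ℂ) * G - PowerSeries.C (3 : ℂ) * (PowerSeries.X * G) := by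
    have h1 : PowerSeries.C (2 * x : ℂ) = PowerSeries.C z + PowerSeries.C w := by
      rw [← map_add, hadd]
    have h2 : PowerSeries.C z * PowerSeries.C w = 1 := by rw [← map_mul, hmul, map_one]
    have h3 : PowerSeries.C (3 * x : ℂ) =
        PowerSeries.C (3 / 2 * z) + PowerSeries.C (3 / 2 * w) := by
      rw [← map_add]; congr 1; linear_combination (-3 / 2 : ℂ) * hadd
    have h4 : PowerSeries.C (3 : ℂ) = PowerSeries.C (3 / 2 * z) * PowerSeries.C w +
        PowerSeries.C (3 / 2 * w) * PowerSeries.C z := by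
      rw [← map_mul, ← map_mul, ← map_add]; congr 1; linear_combination (-3 : ℂ) * hmul
    have h5 : PowerSeries.derivative ℂ G =
        oneSubPowNegThreeHalves z * PowerSeries.derivative ℂ (oneSubPowNegThreeHalves w) +
        oneSubPowNegThreeHalves w * PowerSeries.derivative ℂ (oneSubPowNegThreeHalves z) := by
      rw [hG, Derivation.leibniz, smul_eq_mul, smul_eq_mul]
    rw [h1, h3, h4]
    linear_combination (oneSubPowNegThreeHalves w * (1 - PowerSeries.C w * PowerSeries.X)) * hz +
      (oneSubPowNegThreeHalves z * (1 - PowerSeries.C z * PowerSeries.X)) * hw -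
      PowerSeries.X ^ 2 * PowerSeries.derivative ℂ G * h2 +
      (1 - PowerSeries.C z * PowerSeries.X) * (1 - PowerSeries.C w * PowerSeries.X) * h5
  have hG0 : PowerSeries.coeff 0 G = 1 := by
    simp [hG, PowerSeries.coeff_mul, oneSubPowNegThreeHalves]
  induction n using Nat.twoStepInduction with
  | zero => simp [hG0, derivative_legendre_one]
  | one =>
    have h := congrArg (PowerSeries.coeff 0) hode
    have hr := eval_derivative_legendre_recurrence 0 x
    simp only [derivative_legendre_zero, derivative_legendre_one, eval_one, eval_zero,
      Nat.cast_zero, zero_add] at hr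
    simp only [map_add, map_sub, PowerSeries.coeff_C_mul, PowerSeries.coeff_zero_X_mul,
      PowerSeries.coeff_derivative, hG0] at h
    have hr' := congrArg ((↑) : ℝ → ℂ) hr
    push_cast at h hr' ⊢
    linear_combination h - hr'
  | more n ih0 ih1 =>
    have h := congrArg (PowerSeries.coeff (n + 1)) hode
    have hr := congrArg ((↑) : ℝ → ℂ) (eval_derivative_legendre_recurrence (n + 1) x)
    have hn : (n + 2 : ℂ) ≠ 0 := by exact_mod_cast (n + 1).succ_ne_zero
    refine mul_left_cancel₀ hn ?_
    cases n with
    | zero =>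
      simp only [map_add, map_sub, PowerSeries.coeff_C_mul, PowerSeries.coeff_succ_X_mul,
        PowerSeries.coeff_zero_X_mul, PowerSeries.coeff_derivative] at h
      push_cast at h hr ih0 ih1 ⊢
      rw [ih0, ih1] at h
      linear_combination h - hr
    | succ n =>
      simp only [map_add, map_sub, PowerSeries.coeff_C_mul, PowerSeries.coeff_succ_X_mul,
        PowerSeries.coeff_derivative] at h
      push_cast at h hr ih0 ih1 ⊢
      rw [ih0, ih1] at h
      linear_combination h - hr

theorem summable_norm_choose_mul_pow (a : ℂ) {s : ℂ} (hs : ‖s‖ < 1) :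
    Summable fun n ↦ ‖Ring.choose a n * s ^ n‖ := by
  have hmem : s ∈ Metric.eball (0 : ℂ) (binomialSeries ℂ a).radius :=
    Metric.eball_subset_eball binomialSeries_radius_ge_one (by
      simpa [enorm_eq_nnnorm, ← NNReal.coe_lt_coe] using hs)
  simpa [binomialSeries, mul_comm] using (binomialSeries ℂ a).summable_norm_apply hmem

theorem hasSum_choose_mul_pow (a : ℂ) {s : ℂ} (hs : ‖s‖ < 1) :
    HasSum (fun n ↦ Ring.choose a n * s ^ n) ((1 + s) ^ a) := by
  have hmem : s ∈ Metric.eball (0 : ℂ) 1 := by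
    simpa [enorm_eq_nnnorm, ← NNReal.coe_lt_coe] using hs
  simpa [binomialSeries, mul_comm] using
    Complex.one_add_cpow_hasFPowerSeriesOnBall_zero (a := a) |>.hasSum hmem

open ComplexConjugate in
theorem cpow_mul_conj_cpow {u : ℂ} (hu : u.arg ≠ Real.pi) (r : ℝ) :
    u ^ (r : ℂ) * conj u ^ (r : ℂ) = ((Complex.normSq u ^ r : ℝ) : ℂ) := by
  rw [Complex.conj_cpow _ _ hu, Complex.conj_ofReal, Complex.mul_conj, Complex.normSq_eq_norm_sq,
    Complex.norm_cpow_real, Complex.normSq_eq_norm_sq, ← Real.rpow_natCast, ← Real.rpow_natCast,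
    ← Real.rpow_mul (norm_nonneg u), ← Real.rpow_mul (norm_nonneg u), mul_comm]

/-- Differentiated generating function:
`Σ_{n=0}^∞ P_n'(x) t^n = t (1 - 2xt + t^2)^{-3/2}` for `-1 ≤ x ≤ 1`, `|t| < 1`. -/
theorem legendre_deriv_generating_function (x t : ℝ) (hx₁ : -1 ≤ x) (hx₂ : x ≤ 1)
    (ht : |t| < 1) :
    HasSum (fun n : ℕ => (derivative (legendre n)).eval x * t ^ n)
      (t * (1 - 2 * x * t + t ^ 2) ^ (-(3 / 2) : ℝ)) := by
  set z : ℂ := ⟨x, √(1 - x ^ 2)⟩ with hz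
  set w : ℂ := starRingEnd ℂ z with hw
  have hsq : √(1 - x ^ 2) * √(1 - x ^ 2) = 1 - x ^ 2 := Real.mul_self_sqrt (by nlinarith)
  have hnormSq : Complex.normSq z = 1 := by rw [hz, Complex.normSq_mk, hsq]; ring
  have hmul : z * w = 1 := by rw [hw, Complex.mul_conj, hnormSq, Complex.ofReal_one]
  have hadd : z + w = 2 * x := by rw [hw, Complex.add_conj]; simp [hz]
  have hz1 : ‖z‖ = 1 := by
    rw [← sq_eq_sq₀ (norm_nonneg z) zero_le_one,
      ← Complex.normSq_eq_norm_sq, hnormSq, one_pow]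
  have hzt : ‖-z * t‖ < 1 := by simpa [hz1] using ht
  have hwt : ‖-w * t‖ < 1 := by simpa [hw, hz1] using ht
  have hprod := (summable_norm_sum_mul_antidiagonal_of_summable_norm
    (summable_norm_choose_mul_pow (-(3 / 2)) hzt)
    (summable_norm_choose_mul_pow (-(3 / 2)) hwt)).of_norm.hasSum
  rw [← tsum_mul_tsum_eq_tsum_sum_antidiagonal_of_summable_norm
    (summable_norm_choose_mul_pow (-(3 / 2)) hzt) (summable_norm_choose_mul_pow (-(3 / 2)) hwt),
    (hasSum_choose_mul_pow _ hzt).tsum_eq, (hasSum_choose_mul_pow _ hwt).tsum_eq] at hprod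
  have harg : (1 + -z * t).arg ≠ Real.pi :=
    Complex.slitPlane_arg_ne_pi (Complex.mem_slitPlane_of_norm_lt_one hzt)
  have hconj : 1 + -w * t = starRingEnd ℂ (1 + -z * t) := by simp [hw]
  have hval : Complex.normSq (1 + -z * t) = 1 - 2 * x * t + t ^ 2 := by
    simp only [hz, Complex.normSq_apply]
    simp
    linear_combination t ^ 2 * hsq
  have hcast : (-(3 / 2) : ℂ) = ((-(3 / 2) : ℝ) : ℂ) := by push_cast; rfl
  have hterm (n : ℕ) : (∑ kl ∈ Finset.HasAntidiagonal.antidiagonal n,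
      Ring.choose (-(3 / 2) : ℂ) kl.1 * (-z * t) ^ kl.1 *
        (Ring.choose (-(3 / 2) : ℂ) kl.2 * (-w * t) ^ kl.2)) =
      (((derivative (legendre (n + 1))).eval x * t ^ n : ℝ) : ℂ) := by
    rw [Complex.ofReal_mul, ← coeff_mul_oneSubPowNegThreeHalves x hadd hmul n,
      PowerSeries.coeff_mul, Finset.sum_mul]
    refine Finset.sum_congr rfl fun kl hkl ↦ ?_
    rw [← Finset.HasAntidiagonal.mem_antidiagonal.1 hkl]
    simp only [oneSubPowNegThreeHalves, PowerSeries.coeff_mk]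
    push_cast
    ring
  simp only [hterm] at hprod
  rw [hconj, hcast, cpow_mul_conj_cpow harg, hval, Complex.hasSum_ofReal] at hprod
  rw [← hasSum_nat_add_iff' 1]
  convert! hprod.mul_left t using 1
  · ext n
    ring
  · simp [derivative_legendre_zero]
end

section
/- For every natural number n ≥ 1, the Legendre polynomials satisfy (2n+1)·P_n(x) = P_{n+1}'(x) - P_{n-1}'(x), as an identity of polynomials. -/
open Polynomial

/-- The second derivative of `(X ^ 2 - 1) ^ (m + 2)`, expressed in powers of `X ^ 2 - 1`. -/
theorem derivative_derivative_X_sq_sub_one_pow (m : ℕ) :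
    derivative (derivative ((X ^ 2 - 1 : ℝ[X]) ^ (m + 2))) =
      C (2 * (m + 2) * (2 * m + 3) : ℝ) * (X ^ 2 - 1) ^ (m + 1) +
        C (4 * (m + 2) * (m + 1) : ℝ) * (X ^ 2 - 1) ^ m := by
  simp [derivative_pow, map_ofNat C]
  ring

theorem derivative_legendre (n : ℕ) :
    derivative (legendre n) =
      C (1 / ((2 : ℝ) ^ n * n.factorial)) * derivative^[n + 1] ((X ^ 2 - 1) ^ n) := by
  rw [legendre, derivative_C_mul, Function.iterate_succ_apply']

/-- `(2n+1) P_n(x) = P_{n+1}'(x) - P_{n-1}'(x)` as an identity of polynomials. -/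
theorem legendre_deriv_difference (n : ℕ) (hn : 1 ≤ n) :
    C (2 * (n : ℝ) + 1) * legendre n =
      derivative (legendre (n + 1)) - derivative (legendre (n - 1)) := by
  obtain ⟨m, rfl⟩ := Nat.exists_eq_add_of_le' hn
  rw [Nat.add_sub_cancel, derivative_legendre, derivative_legendre, legendre,
    Function.iterate_succ_apply _ (m + 2), Function.iterate_succ_apply _ (m + 1),
    derivative_derivative_X_sq_sub_one_pow, iterate_map_add,
    iterate_derivative_C_mul, iterate_derivative_C_mul, mul_add, ← mul_assoc, ← mul_assoc,
    ← mul_assoc, ← C_mul, ← C_mul, ← C_mul, add_sub_assoc, ← sub_mul, ← C_sub]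
  have h₁ : (2 * ((m + 1 : ℕ) : ℝ) + 1) * (1 / (2 ^ (m + 1) * ((m + 1).factorial : ℝ))) =
      1 / (2 ^ (m + 1 + 1) * ((m + 1 + 1).factorial : ℝ)) * (2 * (m + 2) * (2 * m + 3)) := by
    simp only [Nat.factorial_succ]
    push_cast
    field_simp
    ring
  have h₂ : 1 / (2 ^ (m + 1 + 1) * ((m + 1 + 1).factorial : ℝ)) * (4 * (m + 2) * (m + 1)) -
      1 / (2 ^ m * (m.factorial : ℝ)) = 0 := by
    simp only [Nat.factorial_succ]
    push_cast
    field_simp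
    ring
  rw [h₁, h₂, C_0, zero_mul, add_zero]
end
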